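/- arXiv:2102.12543 — 2 statements merged into one kernel-verified Lean document; each statement's English description precedes it below -/
import Mathlib

section
/- k-guessing facets (Proposition, Appendix C.1): Let n' and k be integers with n' − 2 ≥ k ≥ 1, set d = n' − k and n = C(n',k) (the binomial coefficient). Let G_K^{n',k} be the n'×n matrix whose columns are indexed by the k-element subsets S of [n'] and whose (y,S) entry equals 1 if y ∈ S and 0 otherwise. Then (G_K^{n',k}, C(n',k) − 1) is a tight Bell inequality (facet) of C_d^{n→n'}. -/
open Finset

/-- A classical channel: an `n' × n` column-stochastic real matrix. -/
def IsChannel {n n' : ℕ} (P : Matrix (Fin n') (Fin n) ℝ) : Prop :=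
  (∀ y x, 0 ≤ P y x) ∧ ∀ x, ∑ y, P y x = 1

/-- A vertex of the signaling polytope: a column-stochastic 0/1 matrix with
at most `d` nonzero rows. -/
def IsVertex {n n' : ℕ} (d : ℕ) (V : Matrix (Fin n') (Fin n) ℝ) : Prop :=
  IsChannel V ∧ (∀ y x, V y x = 0 ∨ V y x = 1) ∧
    ({y : Fin n' | ∃ x, V y x ≠ 0}).ncard ≤ d

/-- The signaling polytope `C_d^{n → n'}`. -/
def signalingPolytope (n n' d : ℕ) : Set (Matrix (Fin n') (Fin n) ℝ) :=
  convexHull ℝ {V | IsVertex d V}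

/-- The Euclidean inner product `⟨G, P⟩ = ∑_{x,y} G_{y,x} P(y|x)`. -/
def bip {n n' : ℕ} (G P : Matrix (Fin n') (Fin n) ℝ) : ℝ :=
  ∑ x, ∑ y, G y x * P y x

/-- `(G, γ)` is a tight Bell inequality (facet) of `C_d^{n → n'}`: it is valid on the
signaling polytope and is saturated by `n (n' - 1)` affinely independent vertices. -/
def IsTightBell (n n' d : ℕ) (G : Matrix (Fin n') (Fin n) ℝ) (γ : ℝ) : Prop :=
  (∀ P ∈ signalingPolytope n n' d, bip G P ≤ γ) ∧
  ∃ V : Fin (n * (n' - 1)) → Matrix (Fin n') (Fin n) ℝ,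
    AffineIndependent ℝ V ∧ ∀ i, IsVertex d (V i) ∧ bip G (V i) = γ

/-- The matrix of the deterministic channel sending the input `x` to the output `g x`. -/
def detChannel {n n' : ℕ} (g : Fin n → Fin n') : Matrix (Fin n') (Fin n) ℝ :=
  Matrix.of fun y x => if g x = y then 1 else 0

theorem isVertex_detChannel {n n' d : ℕ} {g : Fin n → Fin n'} {R : Finset (Fin n')}
    (hg : ∀ x, g x ∈ R) (hR : R.card ≤ d) : IsVertex d (detChannel g) := by
  refine ⟨⟨fun y x => ?_, fun x => by simp [detChannel]⟩, fun y x => ?_, ?_⟩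
  · simp only [detChannel, Matrix.of_apply]; split_ifs <;> norm_num
  · simp only [detChannel, Matrix.of_apply]; split_ifs <;> simp
  · refine le_trans ?_ hR
    rw [← Set.ncard_coe_finset R]
    refine Set.ncard_le_ncard ?_ R.finite_toSet
    rintro y ⟨x, hx⟩
    have : g x = y := by simpa [detChannel] using hx
    exact this ▸ hg x

theorem bip_detChannel {n n' : ℕ} (G : Matrix (Fin n') (Fin n) ℝ) (g : Fin n → Fin n') :
    bip G (detChannel g) = ∑ x, G (g x) x := by
  simp [bip, detChannel]

theorem map_detChannel {n n' : ℕ} (f : Matrix (Fin n') (Fin n) ℝ →ₗ[ℝ] ℝ) (g : Fin n → Fin n') :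
    f (detChannel g) = ∑ x, f (Matrix.single (g x) x 1) := by
  rw [← map_sum]
  congr 1
  ext y x
  simp [detChannel, Matrix.sum_apply, Matrix.single_apply, and_comm, ite_and]

/-- The strategy `g` avoids the set `B t` and guesses correctly on every input but `t`. -/
def AvoidsExactly {n n' : ℕ} (B : Fin n → Finset (Fin n')) (t : Fin n) (g : Fin n → Fin n') :
    Prop :=
  (∀ x, g x ∉ B t) ∧ ∀ x, x ≠ t → g x ∈ B x

theorem exists_avoidsExactly {n n' k : ℕ} {B : Fin n → Finset (Fin n')}
    (hinj : Function.Injective B) (hB : ∀ x, (B x).card = k) (hk : k < n') (t : Fin n) :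
    ∃ g, AvoidsExactly B t g := by
  have h : ∀ x, ∃ y, y ∉ B t ∧ (x ≠ t → y ∈ B x) := by
    intro x
    by_cases hx : x = t
    · obtain ⟨y, hy⟩ : ∃ y, y ∉ B t := by
        by_contra! hall
        have := Finset.card_le_card (fun y _ => hall y : Finset.univ ⊆ B t)
        simp [hB] at this
        omega
      exact ⟨y, hy, fun h => absurd hx h⟩
    · have : ¬ B x ⊆ B t := fun hs =>
        hx (hinj (Finset.eq_of_subset_of_card_le hs (by simp [hB])))
      obtain ⟨y, hy, hyt⟩ := Finset.not_subset.1 this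
      exact ⟨y, hyt, fun _ => hy⟩
  choose g hg using h
  exact ⟨g, fun x => (hg x).1, fun x => (hg x).2⟩

theorem AvoidsExactly.update {n n' : ℕ} {B : Fin n → Finset (Fin n')} {t : Fin n}
    {g : Fin n → Fin n'} (hg : AvoidsExactly B t g) {x : Fin n} {y : Fin n'} (hy : y ∉ B t)
    (hyx : x ≠ t → y ∈ B x) : AvoidsExactly B t (Function.update g x y) := by
  constructor <;> intro z
  · rcases eq_or_ne z x with rfl | hz
    · simpa using hy
    · simpa [hz] using hg.1 z
  · rcases eq_or_ne z x with rfl | hz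
    · simpa using hyx
    · simpa [hz] using hg.2 z

theorem sum_update_sub {n n' : ℕ} (H : Fin n' → Fin n → ℝ) (g : Fin n → Fin n') (x : Fin n)
    (y : Fin n') :
    ∑ z, H (Function.update g x y z) z = ∑ z, H (g z) z - H (g x) x + H y x := by
  rw [← Finset.add_sum_erase _ _ (Finset.mem_univ x),
    ← Finset.add_sum_erase _ (fun z => H (g z) z) (Finset.mem_univ x),
    Finset.sum_congr rfl fun z hz => by rw [Function.update_of_ne (Finset.ne_of_mem_erase hz)]]
  simp
  ring

/-- A coefficient matrix orthogonal to all the saturating strategies and vanishing at one wrong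
guess for every input is zero. -/
theorem eq_zero_of_forall_avoidsExactly {n n' k : ℕ} {B : Fin n → Finset (Fin n')}
    (hinj : Function.Injective B) (hB : ∀ x, (B x).card = k)
    (hsurj : ∀ S : Finset (Fin n'), S.card = k → ∃ x, B x = S) (hn : n ≠ 1) (hk : k + 2 ≤ n')
    {H : Fin n' → Fin n → ℝ} {w : Fin n → Fin n'} (hw : ∀ x, w x ∉ B x)
    (hHw : ∀ x, H (w x) x = 0)
    (hH : ∀ t g, AvoidsExactly B t g → ∑ x, H (g x) x = 0) (y : Fin n') (x : Fin n) :
    H y x = 0 := by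
  have swap : ∀ t x y y', y ∉ B t → y' ∉ B t → (x ≠ t → y ∈ B x ∧ y' ∈ B x) →
      H y x = H y' x := by
    intro t x y y' hy hy' hx
    obtain ⟨g, hg⟩ := exists_avoidsExactly hinj hB (by omega) t
    have h1 := hH t _ (hg.update hy fun h => (hx h).1)
    have h2 := hH t _ (hg.update hy' fun h => (hx h).2)
    rw [sum_update_sub] at h1 h2
    linarith
  have wrong : ∀ x y, y ∉ B x → H y x = 0 := fun x y hy =>
    (swap x x y (w x) hy (hw x) fun h => absurd rfl h).trans (hHw x)
  have right : ∀ x y y', y ∈ B x → y' ∈ B x → H y x = H y' x := by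
    intro x y y' hy hy'
    obtain ⟨S, hS, hSk⟩ := Finset.exists_subset_card_eq
      (s := (Finset.univ \ {y, y'} : Finset (Fin n'))) (n := k) (by
        have := Finset.le_card_sdiff ({y, y'} : Finset (Fin n')) Finset.univ
        have h2 := Finset.card_le_two (a := y) (b := y')
        simp only [Finset.card_univ, Fintype.card_fin] at this
        omega)
    obtain ⟨t, rfl⟩ := hsurj S hSk
    refine swap t x y y' (fun h => ?_) (fun h => ?_) fun _ => ⟨hy, hy'⟩
    · simpa using hS h
    · simpa using hS h
  by_cases hy : y ∈ B x
  swap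
  · exact wrong x y hy
  have hne : ∀ x, ∃ z, z ∈ B x := fun z => by
    rw [← Finset.Nonempty, ← Finset.card_pos, hB z, ← hB x]
    exact Finset.card_pos.2 ⟨y, hy⟩
  choose c hc using hne
  have hsum : ∀ t, H (c t) t = ∑ z, H (c z) z := by
    intro t
    obtain ⟨g, hg⟩ := exists_avoidsExactly hinj hB (by omega) t
    have h0 := hH t g hg
    rw [← Finset.add_sum_erase _ _ (Finset.mem_univ t), wrong t _ (hg.1 t), zero_add,
      Finset.sum_congr rfl fun z hz => right z _ (c z)
        (hg.2 z (Finset.ne_of_mem_erase hz)) (hc z)] at h0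
    rw [← Finset.add_sum_erase _ _ (Finset.mem_univ t), h0, add_zero]
  have hs : ∑ z, H (c z) z = n * ∑ z, H (c z) z := by
    conv_lhs => rw [Finset.sum_congr rfl fun t _ => hsum t]
    simp
  have hn' : (n : ℝ) - 1 ≠ 0 := sub_ne_zero.2 (by exact_mod_cast hn)
  rw [right x y (c x) hy (hc x), hsum x]
  refine (mul_eq_zero.1 ?_).resolve_left hn'
  linarith

/-- A set whose span has dimension at least `m` contains a linearly independent family of size
`m`. -/
theorem exists_linearIndependent_fin {E : Type*} [AddCommGroup E] [Module ℝ E]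
    [FiniteDimensional ℝ E] {A : Set E} {m : ℕ}
    (hm : m ≤ Module.finrank ℝ (Submodule.span ℝ A)) :
    ∃ V : Fin m → E, LinearIndependent ℝ V ∧ ∀ i, V i ∈ A := by
  obtain ⟨b, hbA, hspan, hb⟩ := exists_linearIndependent ℝ A
  have : Fintype b := hb.setFinite.fintype
  rw [← hspan, finrank_span_set_eq_card hb, Set.toFinset_card] at hm
  obtain ⟨φ⟩ := Function.Embedding.nonempty_of_card_le
    (α := Fin m) (β := b) (by simpa using hm)
  exact ⟨fun i => φ i, hb.comp φ φ.injective, fun i => hbA (φ i).2⟩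

theorem bip_le_of_mem_signalingPolytope {n n' d : ℕ} {G : Matrix (Fin n') (Fin n) ℝ} {γ : ℝ}
    (h : ∀ V, IsVertex d V → bip G V ≤ γ) {P : Matrix (Fin n') (Fin n) ℝ}
    (hP : P ∈ signalingPolytope n n' d) : bip G P ≤ γ := by
  have hlin : IsLinearMap ℝ (bip G) :=
    ⟨fun P Q => by simp [bip, mul_add, Finset.sum_add_distrib],
      fun a P => by simp [bip, Finset.mul_sum, mul_left_comm]⟩
  exact convexHull_min (fun V hV => h V hV) (convex_halfSpace_le hlin γ) hP

/-- k-guessing facets: for `n' - 2 ≥ k ≥ 1`, `d = n' - k` and `n = C(n',k)`, the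
k-guessing game matrix (columns indexed by the k-element subsets `S` of `[n']`,
with `(y,S)` entry `1` iff `y ∈ S`) together with the bound `C(n',k) - 1` is a
tight Bell inequality of `C_{n'-k}^{C(n',k) → n'}`. -/
theorem kGuessingGame_tightBell (n' k : ℕ) (hk1 : 1 ≤ k) (hk2 : k + 2 ≤ n')
    (e : Fin (Nat.choose n' k) ≃ {S : Finset (Fin n') // S.card = k}) :
    IsTightBell (Nat.choose n' k) n' (n' - k)
      (Matrix.of fun (y : Fin n') (x : Fin (Nat.choose n' k)) =>
        if y ∈ (e x).val then (1 : ℝ) else 0)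
      ((Nat.choose n' k : ℝ) - 1) := by
  have hn : n'.choose k ≠ 1 := by
    rw [Ne, Nat.choose_eq_one_iff]
    omega
  generalize n'.choose k = n at e hn
  set B : Fin n → Finset (Fin n') := fun x => (e x).val with hBdef
  have hB : ∀ x, (B x).card = k := fun x => (e x).2
  have hinj : Function.Injective B := Subtype.val_injective.comp e.injective
  have hsurj : ∀ S : Finset (Fin n'), S.card = k → ∃ x, B x = S := fun S hS =>
    ⟨e.symm ⟨S, hS⟩, by simp [hBdef]⟩
  set G : Matrix (Fin n') (Fin n) ℝ :=
    Matrix.of fun y x => if y ∈ (e x).val then (1 : ℝ) else 0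
  have hG1 : ∀ y x, y ∈ B x → G y x = 1 := fun y x h => if_pos h
  have hG0 : ∀ y x, y ∉ B x → G y x = 0 := fun y x h => if_neg h
  refine ⟨fun P hP => bip_le_of_mem_signalingPolytope (fun V hV => ?_) hP, ?_⟩
  · obtain ⟨⟨hpos, hsum⟩, -, hcard⟩ := hV
    classical
    set R : Finset (Fin n') := {y | ∃ x, V y x ≠ 0} with hR
    have hRcard : R.card ≤ n' - k := by
      rw [← Set.ncard_coe_finset]
      simpa [hR] using hcard
    obtain ⟨S, hS, hSk⟩ := Finset.exists_subset_card_eq (s := Rᶜ) (n := k) (by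
      rw [Finset.card_compl, Fintype.card_fin]; omega)
    obtain ⟨t, rfl⟩ := hsurj S hSk
    have hle : ∀ x, ∑ y, G y x * V y x ≤ 1 := fun x => by
      rw [← hsum x]
      refine Finset.sum_le_sum fun y _ => mul_le_of_le_one_left (hpos y x) ?_
      by_cases h : y ∈ B x
      · rw [hG1 y x h]
      · rw [hG0 y x h]; exact zero_le_one
    have ht : ∑ y, G y t * V y t = 0 := Finset.sum_eq_zero fun y _ => by
      by_cases h : y ∈ B t
      · have : ∀ x, V y x = 0 := by simpa [hR] using hS h
        rw [this t, mul_zero]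
      · rw [hG0 y t h, zero_mul]
    rw [bip, ← Finset.add_sum_erase _ _ (Finset.mem_univ t), ht, zero_add]
    refine (Finset.sum_le_sum fun x _ => hle x).trans ?_
    have : 1 ≤ n := t.pos
    simp [Finset.card_erase_of_mem, Nat.cast_sub this]
  · set A : Set (Matrix (Fin n') (Fin n) ℝ) :=
      {V | ∃ t g, AvoidsExactly B t g ∧ V = detChannel g}
    have hexw : ∀ x, ∃ y, y ∉ B x := fun x => by
      obtain ⟨g, hg⟩ := exists_avoidsExactly hinj hB (by omega) x
      exact ⟨g x, hg.1 x⟩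
    choose w hw using hexw
    have htop : Submodule.span ℝ A ⊔
        Submodule.span ℝ (Set.range fun x => Matrix.single (w x) x (1 : ℝ)) = ⊤ := by
      by_contra hne
      obtain ⟨f, hf0, hf⟩ := Submodule.exists_le_ker_of_lt_top _ (lt_top_iff_ne_top.2 hne)
      rw [sup_le_iff, Submodule.span_le, Submodule.span_le] at hf
      refine hf0 (Matrix.ext_linearMap ℝ fun y x => LinearMap.ext_ring ?_)
      refine eq_zero_of_forall_avoidsExactly hinj hB hsurj hn hk2
        (H := fun y x => f (Matrix.single y x 1)) hw (fun x => hf.2 ⟨x, rfl⟩)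
        (fun t g hg => ?_) y x
      rw [← map_detChannel]
      exact hf.1 ⟨t, g, hg, rfl⟩
    have hdim : n * (n' - 1) ≤ Module.finrank ℝ (Submodule.span ℝ A) := by
      have h1 := Submodule.finrank_add_le_finrank_add_finrank (Submodule.span ℝ A)
        (Submodule.span ℝ (Set.range fun x => Matrix.single (w x) x (1 : ℝ)))
      have h2 := finrank_range_le_card (R := ℝ) fun x => Matrix.single (w x) x (1 : ℝ)
      rw [htop, finrank_top, Module.finrank_matrix] at h1
      simp only [Fintype.card_fin, Module.finrank_self, mul_one] at h1 h2
      rw [Nat.mul_sub, mul_one, mul_comm]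
      simp only [Set.finrank] at h2
      omega
    obtain ⟨V, hV, hVA⟩ := exists_linearIndependent_fin hdim
    refine ⟨V, hV.affineIndependent, fun i => ?_⟩
    obtain ⟨t, g, hg, hVg⟩ := hVA i
    rw [hVg]
    refine ⟨isVertex_detChannel (R := (B t)ᶜ) (fun x => by simpa using hg.1 x)
      (by rw [Finset.card_compl, Fintype.card_fin, hB]), ?_⟩
    rw [bip_detChannel, ← Finset.add_sum_erase _ _ (Finset.mem_univ t), hG0 _ _ (hg.1 t),
      Finset.sum_congr rfl fun x hx => hG1 _ _ (hg.2 x (Finset.ne_of_mem_erase hx))]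
    have : 1 ≤ n := t.pos
    simp [Finset.card_erase_of_mem, Nat.cast_sub this]
end

section
/- k-guessing facets for one bit (Proposition, Appendix C.1): Let n' ≥ 3 be an integer, set k = n' − 2, d = 2, and n = C(n', n'−2). Let G_K^{n',n'−2} be the n'×n matrix whose columns are indexed by the (n'−2)-element subsets S of [n'] and whose (y,S) entry equals 1 if y ∈ S and 0 otherwise. Then (G_K^{n',n'−2}, C(n',n'−2) − 1) is a tight Bell inequality (facet) of the signaling polytope C_2^{n→n'}. -/
open Finset

/-- The `0/1` channel that deterministically outputs `f x` on input `x`. -/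
def deterministicChannel {n n' : ℕ} (f : Fin n → Fin n') : Matrix (Fin n') (Fin n) ℝ :=
  Matrix.of fun y x => if y = f x then 1 else 0

/-- The guessing-game matrix whose column `x` is the indicator of the set `S x`. -/
def guessingMatrix {n n' : ℕ} (S : Fin n → Finset (Fin n')) : Matrix (Fin n') (Fin n) ℝ :=
  Matrix.of fun y x => if y ∈ S x then 1 else 0

lemma isLinearMap_bip {n n' : ℕ} (G : Matrix (Fin n') (Fin n) ℝ) :
    IsLinearMap ℝ (bip G) where
  map_add P Q := by simp [bip, mul_add, sum_add_distrib]
  map_smul c P := by simp [bip, mul_sum, mul_left_comm]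

lemma isVertex_deterministicChannel {n n' : ℕ} {f : Fin n → Fin n'} {p q : Fin n'}
    (hf : ∀ x, f x = p ∨ f x = q) : IsVertex 2 (deterministicChannel f) := by
  refine ⟨⟨fun y x => ?_, fun x => ?_⟩, fun y x => ?_, ?_⟩
  · simp only [deterministicChannel, Matrix.of_apply]; split_ifs <;> norm_num
  · simp [deterministicChannel]
  · simp only [deterministicChannel, Matrix.of_apply]; split_ifs <;> simp
  · refine (Set.ncard_le_ncard (t := {p, q}) ?_ (Set.toFinite _)).trans ?_
    swap
    · rw [Set.ncard_eq_toFinset_card']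
      simpa using card_le_two
    rintro y ⟨x, hx⟩
    have : y = f x := by
      by_contra h
      exact hx (by simp [deterministicChannel, h])
    simpa [this] using hf x

lemma bip_guessingMatrix_deterministicChannel {n n' : ℕ} (S : Fin n → Finset (Fin n'))
    (f : Fin n → Fin n') :
    bip (guessingMatrix S) (deterministicChannel f) = ∑ x, if f x ∈ S x then (1 : ℝ) else 0 := by
  simp [bip, guessingMatrix, deterministicChannel]

lemma map_deterministicChannel {n n' : ℕ} (φ : Module.Dual ℝ (Matrix (Fin n') (Fin n) ℝ))
    (f : Fin n → Fin n') :
    φ (deterministicChannel f) = ∑ x, φ (Matrix.single (f x) x 1) := by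
  rw [← map_sum]
  congr 1
  ext y x
  rw [Matrix.sum_apply, sum_eq_single x]
  · simp [deterministicChannel, Matrix.single_apply, eq_comm]
  · intro b _ hb
    simp [hb]
  · simp

/-- A strategy with outputs in `{p, q}` answers every question correctly except the one whose
answer set misses both `p` and `q`. -/
structure IsOptimalStrategy {n n' : ℕ} (S : Fin n → Finset (Fin n')) (p q : Fin n')
    (f : Fin n → Fin n') : Prop where
  ne : p ≠ q
  eq_or_eq : ∀ x, f x = p ∨ f x = q
  mem_iff : ∀ x, f x ∈ S x ↔ p ∈ S x ∨ q ∈ S x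

lemma isOptimalStrategy_ite {n n' : ℕ} (S : Fin n → Finset (Fin n')) {p q : Fin n'}
    (hpq : p ≠ q) : IsOptimalStrategy S p q fun x => if p ∈ S x then p else q where
  ne := hpq
  eq_or_eq x := by split_ifs <;> simp
  mem_iff x := by split_ifs with h <;> simp [h]

lemma IsOptimalStrategy.update {n n' : ℕ} {S : Fin n → Finset (Fin n')} {p q : Fin n'}
    {f : Fin n → Fin n'} (hf : IsOptimalStrategy S p q f) {x : Fin n}
    (hx : p ∈ S x ↔ q ∈ S x) {r : Fin n'} (hr : r = p ∨ r = q) :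
    IsOptimalStrategy S p q (Function.update f x r) where
  ne := hf.ne
  eq_or_eq z := by
    rcases eq_or_ne z x with rfl | h
    · simpa using hr
    · simpa [h] using hf.eq_or_eq z
  mem_iff z := by
    rcases eq_or_ne z x with rfl | h
    · rcases hr with rfl | rfl <;> simp [hx]
    · simpa [h] using hf.mem_iff z

lemma card_compl_eq_two {n' : ℕ} (hn' : 2 ≤ n') {S : Finset (Fin n')} (hS : #S = n' - 2) :
    #Sᶜ = 2 := by
  rw [card_compl, Fintype.card_fin]
  omega

lemma exists_eq_compl {n n' : ℕ} (e : Fin n ≃ {S : Finset (Fin n') // S.card = n' - 2})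
    {T : Finset (Fin n')} (hT : #T = 2) : ∃ x, (e x).val = Tᶜ :=
  ⟨e.symm ⟨Tᶜ, by rw [card_compl, Fintype.card_fin, hT]⟩, by simp⟩

lemma forall_mem_or_mem_iff_ne {n n' : ℕ} (hn' : 2 ≤ n')
    (e : Fin n ≃ {S : Finset (Fin n') // S.card = n' - 2}) {p q : Fin n'} (hpq : p ≠ q) {z : Fin n}
    (hz : p ∉ (e z).val ∧ q ∉ (e z).val) (x : Fin n) :
    (p ∈ (e x).val ∨ q ∈ (e x).val) ↔ x ≠ z := by
  have key : ∀ w, p ∉ (e w).val → q ∉ (e w).val → (e w).val = {p, q}ᶜ := fun w hp hq => by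
    rw [← compl_inj_iff, compl_compl]
    refine (eq_of_subset_of_card_le ?_ ?_).symm
    · simp [insert_subset_iff, hp, hq]
    · rw [card_pair hpq, card_compl_eq_two hn' (e w).2]
  refine ⟨?_, fun hx => ?_⟩
  · rintro h rfl
    tauto
  · by_contra! h
    exact hx (e.injective (Subtype.ext ((key x h.1 h.2).trans (key z hz.1 hz.2).symm)))

lemma exists_notMem_notMem {n n' : ℕ} (e : Fin n ≃ {S : Finset (Fin n') // S.card = n' - 2})
    {p q : Fin n'} (hpq : p ≠ q) : ∃ z, p ∉ (e z).val ∧ q ∉ (e z).val := by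
  obtain ⟨z, hz⟩ := exists_eq_compl e (card_pair hpq)
  exact ⟨z, by simp [hz]⟩

lemma IsOptimalStrategy.bip_eq {n n' : ℕ} (hn' : 2 ≤ n')
    (e : Fin n ≃ {S : Finset (Fin n') // S.card = n' - 2}) {p q : Fin n'} {f : Fin n → Fin n'}
    (hf : IsOptimalStrategy (fun x => (e x).val) p q f) :
    bip (guessingMatrix fun x => (e x).val) (deterministicChannel f) = n - 1 := by
  obtain ⟨z, hz⟩ := exists_notMem_notMem e hf.ne
  rw [bip_guessingMatrix_deterministicChannel]
  have hscore (x) : (if f x ∈ (e x).val then (1 : ℝ) else 0) = 1 - if x = z then 1 else 0 := by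
    have := (hf.mem_iff x).trans (forall_mem_or_mem_iff_ne hn' e hf.ne hz x)
    by_cases h : x = z <;> simp_all
  simp_rw [hscore]
  simp

lemma bip_guessingMatrix_le {n n' : ℕ} (hn' : 2 ≤ n')
    (e : Fin n ≃ {S : Finset (Fin n') // S.card = n' - 2}) {V : Matrix (Fin n') (Fin n) ℝ}
    (hV : IsVertex 2 V) : bip (guessingMatrix fun x => (e x).val) V ≤ n - 1 := by
  classical
  obtain ⟨⟨hpos, hsum⟩, -, hcard⟩ := hV
  rw [Set.ncard_eq_toFinset_card'] at hcard
  obtain ⟨T, hT, hT2⟩ := exists_superset_card_eq hcard (by simpa using hn')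
  obtain ⟨z, hz⟩ := exists_eq_compl e hT2
  calc bip (guessingMatrix fun x => (e x).val) V
      ≤ ∑ x, (1 - if x = z then (1 : ℝ) else 0) := by
        refine sum_le_sum fun x _ => ?_
        split_ifs with hx
        · subst hx
          rw [sub_self]
          refine (sum_eq_zero fun y _ => ?_).le
          by_cases hy : V y x = 0
          · simp [hy]
          · have : y ∈ T := hT (by simpa using ⟨x, hy⟩)
            simp [guessingMatrix, hz, this]
        · rw [sub_zero, ← hsum x]
          refine sum_le_sum fun y _ => ?_
          simp only [guessingMatrix, Matrix.of_apply]
          split_ifs <;> simp [hpos]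
    _ = n - 1 := by simp

/-- A functional vanishing on all optimal strategies is constant, in each column, on the rows
inside `S x` and on the rows outside `S x`. -/
lemma map_single_eq_of_mem_iff {n n' : ℕ} {S : Fin n → Finset (Fin n')}
    {φ : Module.Dual ℝ (Matrix (Fin n') (Fin n) ℝ)}
    (hφ : ∀ p q f, IsOptimalStrategy S p q f → φ (deterministicChannel f) = 0)
    {p q : Fin n'} {x : Fin n} (h : p ∈ S x ↔ q ∈ S x) :
    φ (Matrix.single p x 1) = φ (Matrix.single q x 1) := by
  rcases eq_or_ne p q with rfl | hpq
  · rfl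
  have hf := isOptimalStrategy_ite S hpq
  have h1 := hφ _ _ _ (hf.update h (.inl rfl))
  have h2 := hφ _ _ _ (hf.update h (.inr rfl))
  rw [map_deterministicChannel, ← add_sum_erase _ _ (mem_univ x)] at h1 h2
  rw [Function.update_self] at h1 h2
  have h3 : ∀ r, ∑ z ∈ univ.erase x, φ (Matrix.single
      (Function.update (fun x => if p ∈ S x then p else q) x r z) z 1) =
      ∑ z ∈ univ.erase x, φ (Matrix.single (if p ∈ S z then p else q) z 1) := fun r =>
    sum_congr rfl fun z hz => by rw [Function.update_of_ne (ne_of_mem_erase hz)]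
  rw [h3] at h1 h2
  linarith

lemma eq_zero_of_forall_map_single_eq_zero {n n' : ℕ} (hn' : 3 ≤ n') (hn : n ≠ 1)
    (e : Fin n ≃ {S : Finset (Fin n') // S.card = n' - 2})
    {φ : Module.Dual ℝ (Matrix (Fin n') (Fin n) ℝ)}
    (hφ : ∀ p q f, IsOptimalStrategy (fun x => (e x).val) p q f → φ (deterministicChannel f) = 0)
    {r : Fin n → Fin n'} (hr : ∀ x, r x ∉ (e x).val)
    (h0 : ∀ x, φ (Matrix.single (r x) x 1) = 0) : φ = 0 := by
  have hout {y x} (hy : y ∉ (e x).val) : φ (Matrix.single y x 1) = 0 :=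
    (map_single_eq_of_mem_iff hφ (by simp [hy, hr])).trans (h0 x)
  have hne (x) : (e x).val.Nonempty := by
    rw [← card_pos, (e x).2]
    omega
  choose s hs using hne
  have hin {y x} (hy : y ∈ (e x).val) :
      φ (Matrix.single y x 1) = φ (Matrix.single (s x) x 1) :=
    map_single_eq_of_mem_iff hφ (by simp [hy, hs])
  set t : Fin n → ℝ := fun x => φ (Matrix.single (s x) x 1) with ht
  have hsum (z) : t z = ∑ x, t x := by
    obtain ⟨p, q, hpq, hT⟩ := card_eq_two.1 (card_compl_eq_two (by omega) (e z).2)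
    have hz : p ∉ (e z).val ∧ q ∉ (e z).val := by simp [← mem_compl, hT]
    have hf := isOptimalStrategy_ite (fun x => (e x).val) hpq
    have h1 := hφ _ _ _ hf
    rw [map_deterministicChannel] at h1
    have h2 (x) : φ (Matrix.single (if p ∈ (e x).val then p else q) x 1) =
        t x - if x = z then t z else 0 := by
      have hx := (hf.mem_iff x).trans (forall_mem_or_mem_iff_ne (by omega) e hpq hz x)
      by_cases h : x = z
      · rw [hout (by simpa [h] using hx)]
        simp [h]
      · rw [hin (hx.2 h)]
        simp [h, ht]
    simp only [h2, sum_sub_distrib, sum_ite_eq', mem_univ, if_true] at h1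
    linarith
  have hT : ∑ x, t x = 0 := by
    have h1 : ∑ x, t x = n * ∑ x, t x := by
      conv_lhs => rw [sum_congr rfl fun x _ => hsum x]
      simp
    have h2 : ((n : ℝ) - 1) * ∑ x, t x = 0 := by linarith
    refine (mul_eq_zero.1 h2).resolve_left (sub_ne_zero.2 ?_)
    exact_mod_cast hn
  refine Matrix.ext_linearMap _ fun y x => LinearMap.ext_ring ?_
  by_cases hy : y ∈ (e x).val
  · simpa [hT] using (hin hy).trans (hsum x)
  · simpa using hout hy

lemma le_finrank_span_optimal {n n' : ℕ} (hn' : 3 ≤ n') (hn : n ≠ 1)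
    (e : Fin n ≃ {S : Finset (Fin n') // S.card = n' - 2}) :
    n * (n' - 1) ≤ Module.finrank ℝ (Submodule.span ℝ {V : Matrix (Fin n') (Fin n) ℝ |
      ∃ p q f, IsOptimalStrategy (fun x => (e x).val) p q f ∧ deterministicChannel f = V}) := by
  set W := Submodule.span ℝ {V : Matrix (Fin n') (Fin n) ℝ |
      ∃ p q f, IsOptimalStrategy (fun x => (e x).val) p q f ∧ deterministicChannel f = V} with hW
  have hne (x) : ((e x).val)ᶜ.Nonempty := by
    rw [← card_pos, card_compl_eq_two (by omega) (e x).2]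
    omega
  choose r hr using hne
  let ev : W.dualAnnihilator →ₗ[ℝ] Fin n → ℝ :=
    (LinearMap.pi fun x => LinearMap.applyₗ (Matrix.single (r x) x (1 : ℝ))) ∘ₗ
      W.dualAnnihilator.subtype
  have hev : Function.Injective ev := by
    rw [injective_iff_map_eq_zero]
    rintro ⟨φ, hφ⟩ h
    rw [Submodule.mem_dualAnnihilator] at hφ
    rw [Submodule.mk_eq_zero]
    exact eq_zero_of_forall_map_single_eq_zero hn' hn e
      (fun p q f hf => hφ _ (Submodule.subset_span ⟨p, q, f, hf, rfl⟩))
      (fun x => mem_compl.1 (hr x)) fun x => congrFun h x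
  have h1 := LinearMap.finrank_le_finrank_of_injective hev
  have h2 := Subspace.finrank_add_finrank_dualAnnihilator_eq W
  rw [Module.finrank_fin_fun] at h1
  rw [Module.finrank_matrix, Module.finrank_self, mul_one, Fintype.card_fin, Fintype.card_fin,
    mul_comm] at h2
  rw [Nat.mul_sub_one]
  omega

lemma isTightBell_guessingMatrix {n n' : ℕ} (hn' : 3 ≤ n') (hn : n ≠ 1)
    (e : Fin n ≃ {S : Finset (Fin n') // S.card = n' - 2}) :
    IsTightBell n n' 2 (guessingMatrix fun x => (e x).val) (n - 1) := by
  refine ⟨fun P hP => ?_, ?_⟩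
  · exact convexHull_min (fun V hV => bip_guessingMatrix_le (by omega) e hV)
      (convex_halfSpace_le (isLinearMap_bip _) _) hP
  · obtain ⟨F, hF, -, hind⟩ := Submodule.exists_fun_fin_finrank_span_eq ℝ
      {V : Matrix (Fin n') (Fin n) ℝ | ∃ p q f,
        IsOptimalStrategy (fun x => (e x).val) p q f ∧ deterministicChannel f = V}
    have hle := le_finrank_span_optimal hn' hn e
    refine ⟨F ∘ Fin.castLE hle, (hind.comp _ (Fin.castLE_injective hle)).affineIndependent,
      fun i => ?_⟩
    obtain ⟨p, q, f, hf, hfV⟩ := hF (Fin.castLE hle i)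
    rw [Function.comp_apply, ← hfV]
    exact ⟨isVertex_deterministicChannel hf.eq_or_eq, hf.bip_eq (by omega) e⟩

/-- k-guessing facets for one bit: for `n' ≥ 3`, `k = n' - 2`, `d = 2` and
`n = C(n', n'-2)`, the k-guessing game matrix together with the bound
`C(n', n'-2) - 1` is a tight Bell inequality of `C_2^{C(n',n'-2) → n'}`. -/
theorem kGuessingGame_tightBell_oneBit (n' : ℕ) (hn' : 3 ≤ n')
    (e : Fin (Nat.choose n' (n' - 2)) ≃ {S : Finset (Fin n') // S.card = n' - 2}) :
    IsTightBell (Nat.choose n' (n' - 2)) n' 2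
      (Matrix.of fun (y : Fin n') (x : Fin (Nat.choose n' (n' - 2))) =>
        if y ∈ (e x).val then (1 : ℝ) else 0)
      ((Nat.choose n' (n' - 2) : ℝ) - 1) := by
  refine isTightBell_guessingMatrix hn' (fun h => ?_) e
  rw [Nat.choose_symm (by omega)] at h
  have := Nat.choose_le_choose 2 hn'
  rw [h] at this
  exact absurd this (by decide)
end
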